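/- Let n ≥ 4 and let f ∈ ℂ[x_1,...,x_n] be a symmetric polynomial such that substituting x_2 := x_1 and x_4 := x_3 into f yields zero. Then there exists a polynomial g ∈ ℂ[z, x_4,...,x_n], symmetric under all permutations of x_4,...,x_n, such that f(z,z,z,x_4,...,x_n) = ∏_{i=4}^{n} (z − x_i)³ · ∏_{4≤i<j≤n} (x_i − x_j)² · g(z, x_4,...,x_n). -/

import Mathlib

open MvPolynomial Finset

section
variable {σ R : Type*} [CommRing R]

theorem X_sub_X_dvd_iff [DecidableEq σ] (a b : σ) (p : MvPolynomial σ R) :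
    X a - X b ∣ p ↔ aeval (Function.update X a (X b) : σ → MvPolynomial σ R) p = 0 := by
  constructor
  · rintro ⟨q, rfl⟩
    by_cases h : b = a <;> simp [h]
  · intro h
    have key : (Ideal.Quotient.mkₐ R (Ideal.span {(X a - X b : MvPolynomial σ R)})).comp
        (aeval (Function.update X a (X b) : σ → MvPolynomial σ R)) =
        Ideal.Quotient.mkₐ R (Ideal.span {(X a - X b : MvPolynomial σ R)}) := by
      refine algHom_ext fun i => ?_
      by_cases hi : i = a
      · subst hi
        simp only [AlgHom.comp_apply, aeval_X, Function.update_self, Ideal.Quotient.mkₐ_eq_mk]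
        refine (Ideal.Quotient.eq.2 ?_).symm
        exact Ideal.mem_span_singleton_self _
      · simp [hi]
    have h2 := congrArg (fun F => F p) key
    simp only [AlgHom.comp_apply, h, map_zero, Ideal.Quotient.mkₐ_eq_mk] at h2
    exact Ideal.mem_span_singleton.1 (Ideal.Quotient.eq_zero_iff_mem.1 h2.symm)

theorem X_sub_X_prime [IsDomain R] {a b : σ} (hab : a ≠ b) :
    Prime (X a - X b : MvPolynomial σ R) := by
  classical
  refine ⟨sub_ne_zero.2 fun h => hab (X_injective h), fun h => ?_, fun p q h => ?_⟩
  · have := (X_sub_X_dvd_iff a b (1 : MvPolynomial σ R)).1 h.dvd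
    simp at this
  · simpa [X_sub_X_dvd_iff] using h

theorem X_sub_X_isRelPrime [IsDomain R] {a b c d : σ} (hab : a ≠ b) (hcd : c ≠ d)
    (h : ¬(a = c ∧ b = d)) (h' : ¬(a = d ∧ b = c)) :
    IsRelPrime (X a - X b : MvPolynomial σ R) (X c - X d) := by
  classical
  rw [(X_sub_X_prime hab).irreducible.isRelPrime_iff_not_dvd, X_sub_X_dvd_iff]
  have hX : Function.Injective (X : σ → MvPolynomial σ R) := X_injective
  simp only [map_sub, aeval_X, Function.update_apply, sub_eq_zero]
  split_ifs <;> simp only [hX.eq_iff] <;> grind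

theorem pderiv_aeval_eq_sum [Fintype σ] {τ : Type*} (s : σ → MvPolynomial τ R) (j : τ)
    (p : MvPolynomial σ R) :
    pderiv j (aeval s p) = ∑ i, aeval s (pderiv i p) * pderiv j (s i) := by
  classical
  induction p using MvPolynomial.induction_on with
  | C a => simp
  | add p q hp hq => simp only [map_add, hp, hq, add_mul, Finset.sum_add_distrib]
  | mul_X p k hp =>
    simp only [map_mul, aeval_X, Derivation.leibniz, hp, smul_eq_mul, map_add, add_mul,
      Finset.sum_add_distrib, pderiv_X, Finset.mul_sum]
    congr 1
    · rw [Finset.sum_eq_single k] <;> simp +contextual [eq_comm]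
    · exact Finset.sum_congr rfl fun i _ => by ring

theorem X_sub_X_pow_three_dvd [IsDomain R] [CharZero R] [DecidableEq σ] {a b : σ} (hab : a ≠ b)
    (p : MvPolynomial σ R)
    (h0 : aeval (Function.update X a (X b) : σ → MvPolynomial σ R) p = 0)
    (h1 : aeval (Function.update X a (X b) : σ → MvPolynomial σ R) (pderiv a p) = 0)
    (h2 : aeval (Function.update X a (X b) : σ → MvPolynomial σ R) (pderiv a (pderiv a p)) = 0) :
    (X b - X a) ^ 3 ∣ p := by
  have hd : pderiv a (X a - X b : MvPolynomial σ R) = 1 := by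
    simp [pderiv_X_of_ne hab.symm]
  obtain ⟨q, rfl⟩ := (X_sub_X_dvd_iff a b p).2 h0
  have hq : aeval (Function.update X a (X b) : σ → MvPolynomial σ R) q = 0 := by
    simpa [hd, Function.update_of_ne hab.symm] using h1
  obtain ⟨r, rfl⟩ := (X_sub_X_dvd_iff a b q).2 hq
  have hr : aeval (Function.update X a (X b) : σ → MvPolynomial σ R) r = 0 := by
    simpa [hd, Function.update_of_ne hab.symm, ← two_mul] using h2
  obtain ⟨t, rfl⟩ := (X_sub_X_dvd_iff a b r).2 hr
  exact ⟨-t, by ring⟩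

theorem X_sub_X_sq_dvd_of_rename_swap [IsDomain R] [CharZero R] [DecidableEq σ] {a b : σ}
    (hab : a ≠ b) (p : MvPolynomial σ R) (hs : rename (Equiv.swap a b) p = p)
    (h0 : aeval (Function.update X a (X b) : σ → MvPolynomial σ R) p = 0) :
    (X a - X b) ^ 2 ∣ p := by
  obtain ⟨q, rfl⟩ := (X_sub_X_dvd_iff a b p).2 h0
  have hne : (X a - X b : MvPolynomial σ R) ≠ 0 := (X_sub_X_prime hab).ne_zero
  have hq : rename (Equiv.swap a b) q = -q := by
    refine mul_left_cancel₀ hne ?_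
    simp only [map_mul, map_sub, rename_X, Equiv.swap_apply_left, Equiv.swap_apply_right] at hs
    linear_combination -hs
  have hc : (aeval (Function.update X a (X b) : σ → MvPolynomial σ R)).comp
      (rename (Equiv.swap a b)) =
      aeval (R := R) (Function.update X a (X b) : σ → MvPolynomial σ R) := by
    refine algHom_ext fun i => ?_
    simp only [AlgHom.comp_apply, rename_X, aeval_X, Function.update_apply,
      Equiv.swap_apply_def]
    grind
  have hz := congrArg (fun F => F q) hc
  simp only [AlgHom.comp_apply, hq, map_neg] at hz
  have hz' : aeval (Function.update X a (X b) : σ → MvPolynomial σ R) q = 0 := by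
    refine (mul_eq_zero.1 (?_ : (2 : MvPolynomial σ R) * _ = 0)).resolve_left two_ne_zero
    linear_combination -hz
  obtain ⟨r, rfl⟩ := (X_sub_X_dvd_iff a b q).2 hz'
  exact ⟨r, by ring⟩
theorem aeval_pderiv_perm {τ : Type*} {f : MvPolynomial σ R} (hf : f.IsSymmetric)
    (t : σ → MvPolynomial τ R) (e : Equiv.Perm σ) (he : ∀ i, t (e i) = t i) (i : σ) :
    aeval t (pderiv (e i) f) = aeval t (pderiv i f) := by
  conv_lhs => rw [← hf e]
  rw [pderiv_rename e.injective, aeval_rename, show t ∘ e = t from funext he]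

theorem aeval_pderiv_pderiv_perm {τ : Type*} {f : MvPolynomial σ R} (hf : f.IsSymmetric)
    (t : σ → MvPolynomial τ R) (e : Equiv.Perm σ) (he : ∀ i, t (e i) = t i) (i j : σ) :
    aeval t (pderiv (e i) (pderiv (e j) f)) = aeval t (pderiv i (pderiv j f)) := by
  conv_lhs => rw [← hf e]
  rw [pderiv_rename e.injective, pderiv_rename e.injective, aeval_rename,
    show t ∘ e = t from funext he]

theorem aeval_pderiv_add_pderiv_eq_zero [Fintype σ] {a b : σ} (hab : a ≠ b)
    (s : σ → MvPolynomial σ R) (ha : s a = X a) (hb : s b = X a)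
    (hs : ∀ i, i ≠ a → i ≠ b → pderiv a (s i) = 0)
    {p : MvPolynomial σ R} (hp : aeval s p = 0) :
    aeval s (pderiv a p + pderiv b p) = 0 := by
  have h := pderiv_aeval_eq_sum s a p
  rw [hp, map_zero, Fintype.sum_eq_add a b hab fun i hi => by rw [hs i hi.1 hi.2, mul_zero],
    ha, hb, pderiv_X_self, mul_one, mul_one] at h
  rw [map_add, ← h]

/-- A symmetric polynomial vanishing on `{x_a = x_b, x_c = x_d}` vanishes to third order in `x_d`
along `{x_a = x_b = x_c = x_d}`. -/
theorem aeval_pderiv_eq_zero_of_symmetric [Fintype σ] [IsDomain R] [CharZero R]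
    {a b c d : σ} (hab : a ≠ b) (hac : a ≠ c) (had : a ≠ d) (hbc : b ≠ c) (hbd : b ≠ d)
    (hcd : c ≠ d) {f : MvPolynomial σ R} (hf : f.IsSymmetric)
    (hv : ∀ t : σ → MvPolynomial σ R, t a = t b → t c = t d → aeval t f = 0)
    (t : σ → MvPolynomial σ R) (hta : t a = t d) (htb : t b = t d) (htc : t c = t d) :
    aeval t (pderiv d f) = 0 ∧ aeval t (pderiv d (pderiv d f)) = 0 := by
  classical
  set s : σ → MvPolynomial σ R := Function.update (Function.update X b (X a)) d (X c) with hs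
  have hsa : s a = X a := by simp [hs, hab, had]
  have hsb : s b = X a := by simp [hs, hbd]
  have hsc : s c = X c := by simp [hs, hbc.symm, hcd]
  have hsd : s d = X c := by simp [hs]
  have hsX : ∀ i, i ≠ b → i ≠ d → s i = X i := fun i h1 h2 => by simp [hs, h1, h2]
  have hDab : ∀ p, aeval s p = 0 → aeval s (pderiv a p + pderiv b p) = 0 := fun p hp => by
    refine aeval_pderiv_add_pderiv_eq_zero hab s hsa hsb (fun i h1 h2 => ?_) hp
    by_cases h : i = d
    · rw [h, hsd, pderiv_X_of_ne hac.symm]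
    · rw [hsX i h2 h, pderiv_X_of_ne h1]
  have hDcd : ∀ p, aeval s p = 0 → aeval s (pderiv c p + pderiv d p) = 0 := fun p hp => by
    refine aeval_pderiv_add_pderiv_eq_zero hcd s hsc hsd (fun i h1 h2 => ?_) hp
    by_cases h : i = b
    · rw [h, hsb, pderiv_X_of_ne hac]
    · rw [hsX i h h2, pderiv_X_of_ne h1]
  have hst : ∀ p, aeval s p = 0 → aeval t p = 0 := fun p hp => by
    have hc : (aeval t).comp (aeval s) = (aeval t : MvPolynomial σ R →ₐ[R] _) := by
      refine algHom_ext fun i => ?_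
      rw [AlgHom.comp_apply, aeval_X, aeval_X]
      by_cases h1 : i = b
      · rw [h1, hsb, aeval_X, hta, htb]
      by_cases h2 : i = d
      · rw [h2, hsd, aeval_X, htc]
      rw [hsX i h1 h2, aeval_X]
    rw [← hc, AlgHom.comp_apply, hp, map_zero]
  have hswap : ∀ i j, t i = t j → ∀ k, t (Equiv.swap i j k) = t k := fun i j h k => by
    rw [Equiv.swap_apply_def]
    split_ifs with h1 h2
    · rw [h1, h]
    · rw [h2, h]
    · rfl
  have hq := hDcd f (hv s (hsa.trans hsb.symm) (hsc.trans hsd.symm))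
  have e1 := hst _ hq
  have e2 := hst _ (hDcd _ hq)
  have e3 := hst _ (hDab _ hq)
  simp only [map_add] at e1 e2 e3
  have s1 := aeval_pderiv_perm hf t _ (hswap c d htc) d
  have s2 := aeval_pderiv_pderiv_perm hf t _ (hswap c d htc) d d
  have s3 := aeval_pderiv_pderiv_perm hf t _ (hswap c d htc) d c
  have s4 := aeval_pderiv_pderiv_perm hf t _ (hswap a d hta) a c
  have s5 := aeval_pderiv_pderiv_perm hf t _ (hswap a c (hta.trans htc.symm)) a d
  have s6 := aeval_pderiv_pderiv_perm hf t _ (hswap b d htb) b c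
  have s7 := aeval_pderiv_pderiv_perm hf t _ (hswap b c (htb.trans htc.symm)) b d
  simp only [Equiv.swap_apply_left, Equiv.swap_apply_right] at s1 s2 s3
  rw [Equiv.swap_apply_left, Equiv.swap_apply_of_ne_of_ne hac.symm hcd] at s4
  rw [Equiv.swap_apply_left, Equiv.swap_apply_of_ne_of_ne had.symm hcd.symm] at s5
  rw [Equiv.swap_apply_left, Equiv.swap_apply_of_ne_of_ne hbc.symm hcd] at s6
  rw [Equiv.swap_apply_left, Equiv.swap_apply_of_ne_of_ne hbd.symm hcd.symm] at s7
  constructor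
  · refine (mul_eq_zero.1 (?_ : (2 : MvPolynomial σ R) * _ = 0)).resolve_left two_ne_zero
    linear_combination e1 - s1
  · refine (mul_eq_zero.1 (?_ : (4 : MvPolynomial σ R) * _ = 0)).resolve_left (by norm_num)
    linear_combination 2 * e2 - 2 * s2 - e3 - s4 - s5 - s6 - s7
end

theorem rename_prod_X_sub_X_sq {σ R : Type*} [Fintype σ] [LinearOrder σ] [CommRing R]
    (S : σ → Prop) [DecidablePred S] (hS : ∀ i j, S i → i < j → S j) (e : Equiv.Perm σ)
    (he : ∀ i, S (e i) ↔ S i) :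
    rename e (∏ p ∈ univ.filter (fun p : σ × σ => S p.1 ∧ p.1 < p.2),
      (X p.1 - X p.2 : MvPolynomial σ R) ^ 2) =
      ∏ p ∈ univ.filter (fun p : σ × σ => S p.1 ∧ p.1 < p.2), (X p.1 - X p.2) ^ 2 := by
  rw [map_prod]
  have he' : ∀ i, S (e.symm i) ↔ S i := fun i => by rw [← he, e.apply_symm_apply]
  have key : ∀ e : Equiv.Perm σ, (∀ i, S (e i) ↔ S i) →
      ∀ p ∈ univ.filter (fun p : σ × σ => S p.1 ∧ p.1 < p.2),
        (min (e p.1) (e p.2), max (e p.1) (e p.2)) ∈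
          univ.filter (fun p : σ × σ => S p.1 ∧ p.1 < p.2) ∧
        (min (e.symm (min (e p.1) (e p.2))) (e.symm (max (e p.1) (e p.2))),
          max (e.symm (min (e p.1) (e p.2))) (e.symm (max (e p.1) (e p.2)))) = p := by
    intro e he p hp
    rw [mem_filter] at hp
    obtain ⟨-, hp1, hlt⟩ := hp
    have hp2 := hS _ _ hp1 hlt
    rcases lt_or_gt_of_ne (e.injective.ne hlt.ne) with h | h
    · rw [min_eq_left h.le, max_eq_right h.le]
      simp [hp1, he, h, hlt.le]
    · rw [min_eq_right h.le, max_eq_left h.le]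
      simp [hp2, he, h, hlt.le]
  refine prod_nbij' (fun p => (min (e p.1) (e p.2), max (e p.1) (e p.2)))
    (fun p => (min (e.symm p.1) (e.symm p.2), max (e.symm p.1) (e.symm p.2)))
    (fun p hp => (key e he p hp).1) (fun p hp => (key e.symm he' p hp).1)
    (fun p hp => (key e he p hp).2) (fun p hp => (key e.symm he' p hp).2) fun p _ => ?_
  simp only [map_pow, map_sub, rename_X]
  rcases le_total (e p.1) (e p.2) with h | h
  · rw [min_eq_left h, max_eq_right h]
  · rw [min_eq_right h, max_eq_left h]
    ring



/-- If a symmetric polynomial `f` in `n ≥ 4` variables vanishes under `x₂ := x₁`, `x₄ := x₃`,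
then `f(z,z,z,x₄,…,x_n) = ∏_{i=4}^n (z-x_i)³ · ∏_{4≤i<j≤n} (x_i-x_j)² · g(z,x₄,…,x_n)` with
`g` symmetric in `x₄,…,x_n`.  Here the variable `X 0` plays the role of `z`, and the
variables `X 3, …, X (n-1)` the roles of `x₄, …, x_n` (0-indexed). -/
theorem factorization_triple_diag (n : ℕ) (hn : 4 ≤ n) (f : MvPolynomial (Fin n) ℂ)
    (hf : f.IsSymmetric)
    (h0 : MvPolynomial.aeval (R := ℂ)
        (fun i : Fin n => if (i : ℕ) = 1 then X (⟨0, by omega⟩ : Fin n)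
          else if (i : ℕ) = 3 then X (⟨2, by omega⟩ : Fin n)
          else (X i : MvPolynomial (Fin n) ℂ)) f = 0) :
    ∃ g : MvPolynomial (Fin n) ℂ,
      (∀ i ∈ g.vars, (i : ℕ) = 0 ∨ 3 ≤ (i : ℕ)) ∧
      (∀ σ : Equiv.Perm (Fin n), (∀ i : Fin n, (i : ℕ) < 3 → σ i = i) →
        rename (⇑σ) g = g) ∧
      MvPolynomial.aeval (R := ℂ)
        (fun i : Fin n => if (i : ℕ) ≤ 2 then X (⟨0, by omega⟩ : Fin n)
          else (X i : MvPolynomial (Fin n) ℂ)) f =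
        (∏ j ∈ Finset.univ.filter (fun j : Fin n => 3 ≤ (j : ℕ)),
            (X (⟨0, by omega⟩ : Fin n) - X j) ^ 3) *
        (∏ p ∈ Finset.univ.filter (fun p : Fin n × Fin n => 3 ≤ (p.1 : ℕ) ∧ p.1 < p.2),
            (X p.1 - X p.2) ^ 2) * g := by
  obtain ⟨a, ha⟩ : ∃ a : Fin n, a = ⟨0, by omega⟩ := ⟨_, rfl⟩
  obtain ⟨b, hb⟩ : ∃ b : Fin n, b = ⟨1, by omega⟩ := ⟨_, rfl⟩
  obtain ⟨c, hc⟩ : ∃ c : Fin n, c = ⟨2, by omega⟩ := ⟨_, rfl⟩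
  obtain ⟨d, hd⟩ : ∃ d : Fin n, d = ⟨3, by omega⟩ := ⟨_, rfl⟩
  simp only [← ha, ← hc] at h0 ⊢
  have hav : (a : ℕ) = 0 := by rw [ha]
  have hbv : (b : ℕ) = 1 := by rw [hb]
  have hcv : (c : ℕ) = 2 := by rw [hc]
  have hdv : (d : ℕ) = 3 := by rw [hd]
  clear ha hb hc hd
  have hv0 : ∀ t : Fin n → MvPolynomial (Fin n) ℂ, t a = t b → t c = t d → aeval t f = 0 := by
    intro t h1 h2
    have hcomp : aeval (R := ℂ) t = (aeval (R := ℂ) t).comp (aeval (R := ℂ)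
        (fun i : Fin n => if (i : ℕ) = 1 then X a
          else if (i : ℕ) = 3 then X c else (X i : MvPolynomial (Fin n) ℂ))) := by
      refine algHom_ext fun i => ?_
      rw [AlgHom.comp_apply, aeval_X, aeval_X]
      split_ifs with h3 h4
      · rw [aeval_X, h1, Fin.ext (h3.trans hbv.symm)]
      · rw [aeval_X, h2, Fin.ext (h4.trans hdv.symm)]
      · rw [aeval_X]
    rw [hcomp, AlgHom.comp_apply, h0, map_zero]
  have hv : ∀ i j : Fin n, 2 ≤ (i : ℕ) → i < j → ∀ t : Fin n → MvPolynomial (Fin n) ℂ,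
      t a = t b → t i = t j → aeval t f = 0 := by
    intro i j hi hij t h1 h2
    rw [← hf (Equiv.swap c i * Equiv.swap d j), aeval_rename]
    have hij' : (i : ℕ) < j := hij
    have ea : (Equiv.swap c i * Equiv.swap d j) a = a := by
      simp only [Equiv.Perm.mul_apply, Equiv.swap_apply_def]; grind
    have eb : (Equiv.swap c i * Equiv.swap d j) b = b := by
      simp only [Equiv.Perm.mul_apply, Equiv.swap_apply_def]; grind
    have ec : (Equiv.swap c i * Equiv.swap d j) c = i := by
      simp only [Equiv.Perm.mul_apply, Equiv.swap_apply_def]; grind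
    have ed : (Equiv.swap c i * Equiv.swap d j) d = j := by
      simp only [Equiv.Perm.mul_apply, Equiv.swap_apply_def]; grind
    apply hv0 <;> simp only [Function.comp_apply, ea, eb, ec, ed, h1, h2]
  clear hv0 h0
  obtain ⟨u, hu⟩ : ∃ u : Fin n → MvPolynomial (Fin n) ℂ,
      u = fun i : Fin n => if (i : ℕ) ≤ 2 then X a else X i := ⟨_, rfl⟩
  rw [← hu]
  have hu0 : ∀ i : Fin n, (i : ℕ) ≤ 2 → u i = X a := fun i hi => by rw [hu]; exact if_pos hi
  have hu1 : ∀ i : Fin n, ¬ (i : ℕ) ≤ 2 → u i = X i := fun i hi => by rw [hu]; exact if_neg hi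
  have hua : u a = X a := hu0 a (by omega)
  -- invariance of the diagonal restriction under permutations of the remaining variables
  have hperm : ∀ e : Equiv.Perm (Fin n), (∀ i : Fin n, (i : ℕ) < 3 → e i = i) →
      ∀ i, 3 ≤ (e i : ℕ) ↔ 3 ≤ (i : ℕ) := by
    intro e he i
    constructor <;> intro h
    · by_contra hlt
      rw [he i (by omega)] at h
      exact hlt h
    · by_contra hlt
      have := e.injective (he (e i) (by omega))
      omega
  have hFsymm : ∀ e : Equiv.Perm (Fin n), (∀ i : Fin n, (i : ℕ) < 3 → e i = i) →
      rename e (aeval u f) = aeval u f := by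
    intro e he
    have hcomm : (rename e).comp (aeval (R := ℂ) u) = (aeval (R := ℂ) u).comp (rename e) := by
      refine algHom_ext fun i => ?_
      rw [AlgHom.comp_apply, AlgHom.comp_apply, aeval_X, rename_X, aeval_X]
      have hi := hperm e he i
      by_cases h : (i : ℕ) ≤ 2
      · rw [hu0 i h, rename_X, he a (by omega), hu0 _ (by omega)]
      · rw [hu1 i h, rename_X, hu1 _ (by omega)]
    have := congrArg (fun F => F f) hcomm
    simpa only [AlgHom.comp_apply, hf e] using this
  have hcompu : ∀ (x y : Fin n) (p : MvPolynomial (Fin n) ℂ),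
      aeval (Function.update X x (X y) : Fin n → MvPolynomial (Fin n) ℂ) (aeval u p) =
      aeval (fun i => aeval (Function.update X x (X y) : Fin n → MvPolynomial (Fin n) ℂ) (u i))
        p := fun x y p => by
    rw [← AlgHom.comp_apply, comp_aeval]
  have hcube : ∀ j : Fin n, 3 ≤ (j : ℕ) → (X a - X j) ^ 3 ∣ aeval u f := by
    intro j hj
    have hja : j ≠ a := by rintro rfl; omega
    have hder : ∀ p : MvPolynomial (Fin n) ℂ, pderiv j (aeval u p) = aeval u (pderiv j p) := by
      intro p
      rw [pderiv_aeval_eq_sum, Fintype.sum_eq_single j, hu1 j (by omega), pderiv_X_self, mul_one]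
      intro i hij
      by_cases h : (i : ℕ) ≤ 2
      · rw [hu0 i h, pderiv_X_of_ne hja.symm, mul_zero]
      · rw [hu1 i h, pderiv_X_of_ne hij, mul_zero]
    have hlow : ∀ i : Fin n, (i : ℕ) ≤ 2 →
        aeval (Function.update X j (X a) : Fin n → MvPolynomial (Fin n) ℂ) (u i) = X a := by
      intro i hi
      rw [hu0 i hi, aeval_X, Function.update_of_ne hja.symm]
    have hjj : aeval (Function.update X j (X a) : Fin n → MvPolynomial (Fin n) ℂ) (u j) = X a := by
      rw [hu1 j (by omega), aeval_X, Function.update_self]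
    have hne : ∀ x y : Fin n, (x : ℕ) ≠ y → x ≠ y := fun x y h h' => h (by rw [h'])
    have key := aeval_pderiv_eq_zero_of_symmetric (hne a b (by omega)) (hne a c (by omega))
      (hne a j (by omega)) (hne b c (by omega)) (hne b j (by omega)) (hne c j (by omega)) hf
      (hv c j (by omega) (Fin.lt_def.2 (by omega)))
      (fun i => aeval (Function.update X j (X a) : Fin n → MvPolynomial (Fin n) ℂ) (u i))
      ((hlow a (by omega)).trans hjj.symm) ((hlow b (by omega)).trans hjj.symm)
      ((hlow c (by omega)).trans hjj.symm)
    apply X_sub_X_pow_three_dvd hja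
    · rw [hcompu]
      exact hv c j (by omega) (Fin.lt_def.2 (by omega)) _
        ((hlow a (by omega)).trans (hlow b (by omega)).symm) ((hlow c (by omega)).trans hjj.symm)
    · rw [hder, hcompu]
      exact key.1
    · rw [hder, hder, hcompu]
      exact key.2
  have hsq : ∀ i j : Fin n, 3 ≤ (i : ℕ) → i < j → (X i - X j) ^ 2 ∣ aeval u f := by
    intro i j hi hij
    have hij' : (i : ℕ) < j := hij
    apply X_sub_X_sq_dvd_of_rename_swap hij.ne
    · refine hFsymm _ fun k hk => Equiv.swap_apply_of_ne_of_ne ?_ ?_ <;> rintro rfl <;> omega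
    · rw [hcompu]
      apply hv i j (by omega) hij
      · rw [hua, hu0 b (by omega)]
      · rw [hu1 i (by omega), hu1 j (by omega), aeval_X, aeval_X, Function.update_self,
          Function.update_of_ne hij.ne']
  obtain ⟨P, hP⟩ : ∃ P : MvPolynomial (Fin n) ℂ,
      P = (∏ j ∈ Finset.univ.filter (fun j : Fin n => 3 ≤ (j : ℕ)), (X a - X j) ^ 3) *
        (∏ p ∈ Finset.univ.filter (fun p : Fin n × Fin n => 3 ≤ (p.1 : ℕ) ∧ p.1 < p.2),
            (X p.1 - X p.2) ^ 2) := ⟨_, rfl⟩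
  rw [← hP]
  have hP0 : P ≠ 0 := by
    rw [hP, mul_ne_zero_iff, prod_ne_zero_iff, prod_ne_zero_iff]
    constructor <;> intro x hx <;> rw [mem_filter] at hx
    · exact pow_ne_zero _ (X_sub_X_prime (by rintro rfl; omega)).ne_zero
    · exact pow_ne_zero _ (X_sub_X_prime hx.2.2.ne).ne_zero
  have hPdvd : P ∣ aeval u f := by
    rw [hP]
    apply IsRelPrime.mul_dvd
    · refine IsRelPrime.prod_left fun j hj => IsRelPrime.prod_right fun p hp => ?_
      rw [mem_filter] at hj hp
      have hp' : (p.1 : ℕ) < p.2 := hp.2.2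
      refine (X_sub_X_isRelPrime ?_ hp.2.2.ne ?_ ?_).pow
      · rintro rfl; omega
      · rintro ⟨rfl, -⟩; omega
      · rintro ⟨rfl, -⟩; omega
    · refine prod_dvd_of_isRelPrime (fun i hi j hj hij => ?_) fun j hj => ?_
      · simp only [coe_filter, Set.mem_ofPred_eq, mem_univ, true_and] at hi hj
        refine (X_sub_X_isRelPrime ?_ ?_ ?_ ?_).pow <;> grind
      · exact hcube j (mem_filter.1 hj).2
    · refine prod_dvd_of_isRelPrime (fun p hp q hq hpq => ?_) fun p hp => ?_
      · simp only [coe_filter, Set.mem_ofPred_eq, mem_univ, true_and] at hp hq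
        refine (X_sub_X_isRelPrime hp.2.ne hq.2.ne ?_ ?_).pow
        · exact fun h => hpq (Prod.ext h.1 h.2)
        · intro h
          have := hp.2
          rw [h.1, h.2] at this
          exact lt_asymm this hq.2
      · rw [mem_filter] at hp
        exact hsq _ _ hp.2.1 hp.2.2
  obtain ⟨g, hg⟩ := hPdvd
  have hPu : aeval u P = P := by
    rw [hP]
    simp only [map_mul, map_prod, map_pow, map_sub, aeval_X, hua]
    refine congrArg₂ (· * ·) (prod_congr rfl fun x hx => ?_) (prod_congr rfl fun x hx => ?_) <;>
      rw [mem_filter] at hx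
    · rw [hu1 x (by omega)]
    · have := Fin.lt_def.1 hx.2.2
      rw [hu1 x.1 (by omega), hu1 x.2 (by omega)]
  have hgu : aeval u g = g := by
    refine mul_left_cancel₀ hP0 ?_
    rw [← hg]
    conv_lhs => rw [← hPu]
    rw [← map_mul, ← hg, ← AlgHom.comp_apply, comp_aeval]
    refine congrArg (fun v => aeval v f) (funext fun i => ?_)
    by_cases h : (i : ℕ) ≤ 2
    · rw [hu0 i h, aeval_X, hua]
    · rw [hu1 i h, aeval_X, hu1 i h]
  refine ⟨g, fun i hi => ?_, fun e he => ?_, hg⟩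
  · rw [← hgu] at hi
    obtain ⟨k, -, hk⟩ := mem_biUnion.1 (vars_bind₁ u g hi)
    by_cases h : (k : ℕ) ≤ 2
    · rw [hu0 k h, vars_X, mem_singleton] at hk
      left; rw [hk, hav]
    · rw [hu1 k h, vars_X, mem_singleton] at hk
      right; rw [hk]; omega
  · have hPe : rename e P = P := by
      rw [hP, map_mul, rename_prod_X_sub_X_sq (fun i : Fin n => 3 ≤ (i : ℕ))
        (fun i j hi hij => hi.trans (Fin.lt_def.1 hij).le) e (hperm e he), map_prod]
      refine congrArg (· * _) ?_
      simp only [map_pow, map_sub, rename_X, he a (by omega)]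
      exact prod_equiv e (by simp [hperm e he]) fun _ _ => rfl
    refine mul_left_cancel₀ hP0 ?_
    rw [← hg]
    conv_lhs => rw [← hPe]
    rw [← map_mul, ← hg, hFsymm e he]
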